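/- In any zigzag-path angle accounting for n points in convex position: for each point p ∈ S, the angles at p occurring across all n zigzag paths are spanned by radially consecutive pairs of the other points, sum to less than π, and hence at most one of them can be ≥ π/2; consequently at least two of the n zigzag spanning paths are 3π/2-open. -/

import Mathlib

open scoped Classical
open EuclideanGeometry

noncomputable section

abbrev Pt := EuclideanSpace ℝ (Fin 2)

/-- No three points of `S` are collinear. -/
def GenPos (S : Finset Pt) : Prop :=
  ∀ p ∈ S, ∀ q ∈ S, ∀ r ∈ S, p ≠ q → p ≠ r → q ≠ r →
    ¬ Collinear ℝ ({p, q, r} : Set Pt)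

/-- `S` is in convex position. -/
def ConvexPos (S : Finset Pt) : Prop :=
  ∀ p ∈ S, p ∉ convexHull ℝ (↑(S.erase p) : Set Pt)

/-- The planar determinant (cross product) of two vectors; `r` is to the left of the
oriented line from `p` through `q` iff `0 < det2 (q - p) (r - p)`. -/
def det2 (u v : Pt) : ℝ := u 0 * v 1 - u 1 * v 0

/-- `f` enumerates `S` as a directed zigzag path with initial turning side `s`: at each
step the next point is the left (resp. right) tangent from the current endpoint to the
remaining points, alternating sides. -/
def IsZigzagSeq (S : Finset Pt) (f : ℕ → Pt) (s : Bool) : Prop :=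
  (∀ i < S.card, f i ∈ S) ∧
  (∀ p ∈ S, ∃ i < S.card, f i = p) ∧
  (∀ i < S.card, ∀ j < S.card, f i = f j → i = j) ∧
  (∀ i j : ℕ, i + 1 < j → j < S.card →
    if decide (Even i) = s then det2 (f (i + 1) - f i) (f j - f i) < 0
    else 0 < det2 (f (i + 1) - f i) (f j - f i))

/-- The set of (undirected) zigzag spanning paths of `S`, each recorded as its set of
undirected edges. -/
def ZigzagPaths (S : Finset Pt) : Set (Finset (Sym2 Pt)) :=
  {E | ∃ f s, IsZigzagSeq S f s ∧
    E = (Finset.range (S.card - 1)).image fun i => s(f i, f (i + 1))}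

end

noncomputable section

/-- The (smaller) angle of a path at `p`: the unsigned angle between the two path edges
at `p`, or `0` if `p` is not an interior vertex of the path `E`. -/
def angleAt (p : Pt) (E : Finset (Sym2 Pt)) : ℝ :=
  if h : ∃ uw : Pt × Pt, uw.1 ≠ uw.2 ∧ s(p, uw.1) ∈ E ∧ s(p, uw.2) ∈ E then
    ∠ h.choose.1 p h.choose.2
  else 0

/-- Every vertex of the path `E` (with vertex set `S`) has an incident angle of size at
least `φ`: all edge directions at each `p ∈ S` fit in a closed cone of half-angle
`π - φ / 2`. -/
def PathOpen (S : Finset Pt) (E : Finset (Sym2 Pt)) (φ : ℝ) : Prop :=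
  ∀ p ∈ S, ∃ d : Pt, d ≠ 0 ∧ ∀ q : Pt, s(p, q) ∈ E → q ≠ p →
    InnerProductGeometry.angle d (q - p) ≤ Real.pi - φ / 2

end

theorem det2_swap (u v : Pt) : det2 v u = -det2 u v := by
  simp only [det2]; ring

theorem det2_self (u : Pt) : det2 u u = 0 := by
  simp only [det2]; ring

theorem ne_zero_of_det2_pos {u v : Pt} (h : 0 < det2 u v) : u ≠ 0 ∧ v ≠ 0 := by
  constructor <;> rintro rfl <;> simp [det2] at h

/-- Translating the base point cyclically does not change the orientation of a triple. -/
theorem det2_sub_rotate (p q r : Pt) : det2 (q - p) (r - p) = det2 (r - q) (p - q) := by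
  simp only [det2, PiLp.sub_apply]; ring

theorem det2_smul_eq (a b c : Pt) : det2 a c • b = det2 b c • a + det2 a b • c := by
  ext i
  fin_cases i <;> simp [det2] <;> ring

theorem det2_sub_ne_zero {S : Finset Pt} (hgp : GenPos S) {p q r : Pt} (hp : p ∈ S) (hq : q ∈ S)
    (hr : r ∈ S) (hpq : p ≠ q) (hpr : p ≠ r) (hqr : q ≠ r) : det2 (q - p) (r - p) ≠ 0 := by
  intro h
  refine hgp p hp q hq r hr hpq hpr hqr ?_
  rw [collinear_iff_of_mem (p₀ := p) (by simp)]
  refine ⟨q - p, ?_⟩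
  have hn : (q - p) 0 ^ 2 + (q - p) 1 ^ 2 ≠ 0 := by
    intro h0
    apply hpq
    have h1 : (q - p) 0 = 0 := by nlinarith [sq_nonneg ((q - p) 0), sq_nonneg ((q - p) 1)]
    have h2 : (q - p) 1 = 0 := by nlinarith [sq_nonneg ((q - p) 0), sq_nonneg ((q - p) 1)]
    ext i
    fin_cases i
    · simp at h1 ⊢; linarith
    · simp at h2 ⊢; linarith
  simp only [Set.mem_insert_iff, Set.mem_singleton_iff, forall_eq_or_imp, forall_eq]
  refine ⟨⟨0, by simp⟩, ⟨1, by simp⟩,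
    ⟨((q - p) 0 * (r - p) 0 + (q - p) 1 * (r - p) 1) / ((q - p) 0 ^ 2 + (q - p) 1 ^ 2), ?_⟩⟩
  rw [vadd_eq_add, ← sub_eq_iff_eq_add]
  generalize q - p = u at *
  generalize r - p = w at *
  simp only [det2] at h
  ext i
  fin_cases i
  · simp only [Fin.zero_eta, Fin.isValue, PiLp.smul_apply, smul_eq_mul]
    field_simp
    linear_combination -(u 1) * h
  · simp only [Fin.mk_one, Fin.isValue, PiLp.smul_apply, smul_eq_mul]
    field_simp
    linear_combination (u 0) * h

/-- In a set in convex position, a point in the angular sector between two others, seen from a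
fourth, lies beyond the segment joining them. -/
theorem det2_pos_of_convexPos {S : Finset Pt} (hgp : GenPos S) (hcp : ConvexPos S) {p a b c : Pt}
    (hp : p ∈ S) (ha : a ∈ S) (hb : b ∈ S) (hc : c ∈ S)
    (hab : 0 < det2 (a - p) (b - p)) (hbc : 0 < det2 (b - p) (c - p))
    (hac : 0 < det2 (a - p) (c - p)) : 0 < det2 (b - a) (c - a) := by
  have hne_ab : a ≠ b := by rintro rfl; simp [det2_self] at hab
  have hne_bc : b ≠ c := by rintro rfl; simp [det2_self] at hbc
  have hne_ac : a ≠ c := by rintro rfl; simp [det2_self] at hac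
  have hne_pb : p ≠ b := by rintro rfl; simp [det2] at hab
  by_contra hneg
  have hlt : det2 (b - a) (c - a) < 0 :=
    lt_of_le_of_ne (not_lt.mp hneg) (det2_sub_ne_zero hgp ha hb hc hne_ab hne_ac hne_bc)
  have hexp : det2 (b - a) (c - a) =
      det2 (b - p) (c - p) - det2 (a - p) (c - p) + det2 (a - p) (b - p) := by
    simp only [det2, PiLp.sub_apply]; ring
  have hb_eq := det2_smul_eq (a - p) (b - p) (c - p)
  set x := det2 (b - p) (c - p)
  set y := det2 (a - p) (b - p)
  set z := det2 (a - p) (c - p)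
  apply hcp b hb
  have hpm : p ∈ convexHull ℝ (↑(S.erase b) : Set Pt) := subset_convexHull ℝ _ (by simp [hp, hne_pb])
  have ham : a ∈ convexHull ℝ (↑(S.erase b) : Set Pt) := subset_convexHull ℝ _ (by simp [ha, hne_ab])
  have hcm : c ∈ convexHull ℝ (↑(S.erase b) : Set Pt) :=
    subset_convexHull ℝ _ (by simp [hc, hne_bc.symm])
  have hcomb := (convex_convexHull ℝ (↑(S.erase b) : Set Pt)).sum_mem
    (t := Finset.univ) (w := ![(z - x - y) / z, x / z, y / z]) (z := ![p, a, c])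
    (by
      intro i _
      fin_cases i
      · exact div_nonneg (by linarith) hac.le
      · exact div_nonneg hbc.le hac.le
      · exact div_nonneg hab.le hac.le)
    (by simp [Fin.sum_univ_three]; field_simp; ring)
    (by
      intro i _
      fin_cases i
      · exact hpm
      · exact ham
      · exact hcm)
  convert hcomb using 1
  simp only [Fin.sum_univ_three, Matrix.cons_val]
  refine smul_right_injective Pt hac.ne' ?_
  simp only [smul_add, smul_smul, mul_div_cancel₀ _ hac.ne']
  have : z • b = z • (b - p) + z • p := by rw [smul_sub]; abel
  rw [this, hb_eq]
  module

/-- A point outside the convex hull of a finite set sees that set in angular order. -/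
theorem exists_det2_pos_ordering {T : Finset Pt} {p : Pt} (hp : p ∉ convexHull ℝ (↑T : Set Pt))
    (hT : ∀ q ∈ T, ∀ r ∈ T, q ≠ r → det2 (q - p) (r - p) ≠ 0) :
    ∃ u : Fin T.card → Pt, (∀ i, u i ∈ T) ∧
      ∀ i j, i < j → 0 < det2 (u i - p) (u j - p) := by
  obtain ⟨f, s, hfp, hfT⟩ := geometric_hahn_banach_point_closed (convex_convexHull ℝ (↑T : Set Pt))
    (T.finite_toSet.isClosed_convexHull ℝ) hp
  have hpos : ∀ q ∈ T, 0 < f (q - p) := fun q hq => by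
    have := hfT q (subset_convexHull ℝ _ (by simpa using hq))
    rw [map_sub]; linarith
  set α := f (EuclideanSpace.single 0 1)
  set β := f (EuclideanSpace.single 1 1)
  have hf : ∀ x : Pt, f x = α * x 0 + β * x 1 := fun x => by
    have : x = x 0 • EuclideanSpace.single 0 1 + x 1 • EuclideanSpace.single 1 1 := by
      ext i
      fin_cases i <;> simp
    conv_lhs => rw [this]
    rw [map_add, map_smul, map_smul, smul_eq_mul, smul_eq_mul]; ring
  let key : Pt → ℝ := fun q => (α * (q - p) 1 - β * (q - p) 0) / f (q - p)
  have hkey : ∀ q ∈ T, ∀ r ∈ T, (key r - key q) * (f (q - p) * f (r - p)) =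
      (α ^ 2 + β ^ 2) * det2 (q - p) (r - p) := fun q hq r hr => by
    have h1 := (hpos q hq).ne'
    have h2 := (hpos r hr).ne'
    simp only [key]
    field_simp
    rw [hf, hf, det2]; ring
  have hαβ : ∀ q ∈ T, 0 < α ^ 2 + β ^ 2 := fun q hq => by
    by_contra h
    have h1 : α = 0 := by nlinarith [sq_nonneg α, sq_nonneg β]
    have h2 : β = 0 := by nlinarith [sq_nonneg α, sq_nonneg β]
    have := hpos q hq
    rw [hf, h1, h2] at this
    simp at this
  have hinj : Set.InjOn key T := fun q hq r hr hqr => by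
    by_contra hne
    have := hkey q hq r hr
    rw [hqr, sub_self, zero_mul] at this
    exact mul_ne_zero (hαβ q hq).ne' (hT q hq r hr hne) this.symm
  have hcard : (T.image key).card = T.card := Finset.card_image_of_injOn hinj
  have hex : ∀ i, ∃ q ∈ T, key q = (T.image key).orderEmbOfFin hcard i := fun i => 
    Finset.mem_image.mp (Finset.orderEmbOfFin_mem (T.image key) hcard i)
  choose u huT hu using hex
  refine ⟨u, huT, fun i j hij => ?_⟩
  have h1 := hkey _ (huT i) _ (huT j)
  have h2 : 0 < key (u j) - key (u i) := by
    rw [hu, hu, sub_pos]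
    exact ((T.image key).orderEmbOfFin hcard).strictMono hij
  have h3 := mul_pos h2 (mul_pos (hpos _ (huT i)) (hpos _ (huT j)))
  rw [h1] at h3
  exact pos_of_mul_pos_right h3 (hαβ _ (huT i)).le

/-- A counterclockwise cyclic labelling of the vertices of a convex polygon. -/
def IsCyclicLabelling {n : ℕ} (v : ZMod n → Pt) : Prop :=
  ∀ (x : ZMod n) (i j : ℕ), 0 < i → i < j → j < n →
    0 < det2 (v (x + i) - v x) (v (x + j) - v x)

theorem exists_linear_labelling {S : Finset Pt} (hgp : GenPos S) (hcp : ConvexPos S)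
    (hS : S.Nonempty) :
    ∃ u : ℕ → Pt, (∀ i < S.card, u i ∈ S) ∧
      ∀ i j k, i < j → j < k → k < S.card → 0 < det2 (u j - u i) (u k - u i) := by
  obtain ⟨p, hp⟩ := hS
  obtain ⟨w, hwT, hw⟩ := exists_det2_pos_ordering (hcp p hp) (fun q hq r hr hqr => by
    simp only [Finset.mem_erase] at hq hr
    exact det2_sub_ne_zero hgp hp hq.2 hr.2 hq.1.symm hr.1.symm hqr)
  have hcard : (S.erase p).card + 1 = S.card := Finset.card_erase_add_one hp
  have hwS : ∀ i, w i ∈ S := fun i => Finset.mem_of_mem_erase (hwT i)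
  let u : ℕ → Pt := fun i =>
    if h : 0 < i ∧ i < S.card then w ⟨i - 1, by omega⟩ else p
  have hu0 : u 0 = p := by simp [u]
  have hu : ∀ i (h0 : 0 < i) (h1 : i < S.card), u i = w ⟨i - 1, by omega⟩ := fun i h0 h1 => by
    simp [u, h0, h1]
  have huS : ∀ i, u i ∈ S := fun i => by
    by_cases h : 0 < i ∧ i < S.card
    · rw [hu i h.1 h.2]; exact hwS _
    · simp only [u, h, dite_false]; exact hp
  have hp_pos : ∀ j k, 0 < j → j < k → k < S.card → 0 < det2 (u j - p) (u k - p) :=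
    fun j k hj hjk hk => by
      rw [hu j hj (hjk.trans hk), hu k (hj.trans hjk) hk]
      exact hw _ _ (by simp only [Fin.mk_lt_mk]; omega)
  refine ⟨u, fun i _ => huS i, fun i j k hij hjk hk => ?_⟩
  rcases Nat.eq_zero_or_pos i with rfl | hi
  · rw [hu0]; exact hp_pos j k hij hjk hk
  · exact det2_pos_of_convexPos hgp hcp hp (huS i) (huS j) (huS k)
      (hp_pos i j hi hij (hjk.trans hk)) (hp_pos j k (hi.trans hij) hjk hk)
      (hp_pos i k hi (hij.trans hjk) hk)

theorem IsCyclicLabelling.injective {n : ℕ} [NeZero n] (hn : 3 ≤ n) {v : ZMod n → Pt}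
    (hv : IsCyclicLabelling v) : Function.Injective v := by
  intro x y hxy
  by_contra hne
  obtain ⟨i, hi, hin, rfl⟩ : ∃ i : ℕ, 0 < i ∧ i < n ∧ y = x + i := by
    refine ⟨(y - x).val, ?_, ZMod.val_lt _, by simp⟩
    rw [Nat.pos_iff_ne_zero, Ne, ZMod.val_eq_zero, sub_eq_zero]
    exact fun h => hne h.symm
  by_cases h : i + 1 < n
  · have := hv x i (i + 1) hi (by omega) h
    simp [← hxy, det2] at this
  · have := hv x 1 i (by omega) (by omega) hin
    simp [← hxy, det2] at this

theorem exists_cyclicLabelling {S : Finset Pt} (hgp : GenPos S) (hcp : ConvexPos S) {n : ℕ}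
    [NeZero n] (hn : 3 ≤ n) (hS : S.card = n) :
    ∃ v : ZMod n → Pt, IsCyclicLabelling v ∧ ∀ p, p ∈ S ↔ ∃ x, v x = p := by
  obtain ⟨u, huS, hu⟩ := exists_linear_labelling hgp hcp (Finset.card_pos.mp (by omega))
  rw [hS] at huS hu
  have hcyc : IsCyclicLabelling (fun x : ZMod n => u x.val) := by
    intro x i j hi hij hj
    have hval : ∀ k : ℕ, k < n → (x + (k : ZMod n)).val = (x.val + k) % n := fun k hk => by
      rw [ZMod.val_add, ZMod.val_natCast, Nat.mod_eq_of_lt hk]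
    have hx := ZMod.val_lt x
    have hwrap : ∀ k : ℕ, k < n → ¬ x.val + k < n → (x.val + k) % n = x.val + k - n :=
      fun k hk h => by
        rw [Nat.mod_eq_sub_mod (by omega), Nat.mod_eq_of_lt (by omega)]
    simp only [hval i (hij.trans hj), hval j hj]
    by_cases h1 : x.val + j < n
    · rw [Nat.mod_eq_of_lt h1, Nat.mod_eq_of_lt (by omega)]
      exact hu _ _ _ (by omega) (by omega) h1
    by_cases h2 : x.val + i < n
    · rw [Nat.mod_eq_of_lt h2, hwrap j hj h1, ← det2_sub_rotate]
      exact hu _ _ _ (by omega) (by omega) h2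
    · rw [hwrap i (hij.trans hj) h2, hwrap j hj h1, det2_sub_rotate]
      exact hu _ _ _ (by omega) (by omega) hx
  refine ⟨_, hcyc, ?_⟩
  have himg : Finset.univ.image (fun x : ZMod n => u x.val) = S := by
    refine Finset.eq_of_subset_of_card_le (fun p hp => ?_) ?_
    · obtain ⟨x, -, rfl⟩ := Finset.mem_image.mp hp
      exact huS _ (ZMod.val_lt x)
    · rw [Finset.card_image_of_injective _ (hcyc.injective hn), Finset.card_univ, ZMod.card, hS]
  intro p
  rw [← himg]
  simp

/-- The edges of a convex polygon's zigzag path: pairs of vertices whose labels sum to one of two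
consecutive residues. -/
noncomputable def zigzagEdges {n : ℕ} [NeZero n] (v : ZMod n → Pt) (c : ZMod n) : Finset (Sym2 Pt) :=
  (Finset.univ.filter fun xy : ZMod n × ZMod n =>
    xy.1 ≠ xy.2 ∧ (xy.1 + xy.2 = c ∨ xy.1 + xy.2 = c + 1)).image fun xy => s(v xy.1, v xy.2)

theorem mem_zigzagEdges {n : ℕ} [NeZero n] {v : ZMod n → Pt} (hv : Function.Injective v)
    {c x : ZMod n} {q : Pt} :
    s(v x, q) ∈ zigzagEdges v c ↔ ∃ y, v y = q ∧ y ≠ x ∧ (y = c - x ∨ y = c - x + 1) := by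
  simp only [zigzagEdges, Finset.mem_image, Finset.mem_filter, Finset.mem_univ, true_and,
    Prod.exists, Sym2.eq_iff]
  constructor
  · rintro ⟨a, b, ⟨hab, hc⟩, ⟨ha, rfl⟩ | ⟨rfl, hb⟩⟩
    · obtain rfl := hv ha
      refine ⟨b, rfl, hab.symm, ?_⟩
      grind
    · obtain rfl := hv hb
      refine ⟨a, rfl, hab, ?_⟩
      grind
  · rintro ⟨y, rfl, hyx, h⟩
    exact ⟨x, y, ⟨hyx.symm, by grind⟩, Or.inl ⟨rfl, rfl⟩⟩

/-- The sequence `0, 1, -1, 2, -2, …`. -/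
def zig (i : ℕ) : ℤ := if Even i then -((i : ℤ) / 2) else ((i : ℤ) + 1) / 2

theorem zig_sub {n i j : ℕ} (hij : i < j) (hj : j < n) :
    ∃ k : ℕ, i + 1 ≤ k ∧ k < n ∧ (i + 1 < j → i + 1 < k) ∧ (j = i + 1 → k = i + 1) ∧
      (zig j : ZMod n) = zig i + (-1) ^ i * k := by
  have key : ∃ k : ℕ, i + 1 ≤ k ∧ k < n ∧ (i + 1 < j → i + 1 < k) ∧ (j = i + 1 → k = i + 1) ∧
      ∃ m : ℤ, zig j = zig i + (-1) ^ i * k + m * n := by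
    rcases Nat.even_or_odd i with hi | hi <;> rcases Nat.even_or_odd j with hj' | hj'
    · obtain ⟨a, rfl⟩ := hi
      obtain ⟨b, rfl⟩ := hj'
      refine ⟨n - (b - a), by omega, by omega, by omega, by omega, -1, ?_⟩
      simp only [zig, Even.add_self, if_true, Even.neg_one_pow]
      omega
    · have hj2 := Nat.not_even_iff_odd.mpr hj'
      obtain ⟨a, rfl⟩ := hi
      obtain ⟨b, rfl⟩ := hj'
      refine ⟨a + b + 1, by omega, by omega, by omega, by omega, 0, ?_⟩
      simp only [zig, Even.add_self, if_true, Even.neg_one_pow, hj2, if_false]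
      omega
    · have hi2 := Nat.not_even_iff_odd.mpr hi
      rw [Odd.neg_one_pow hi]
      obtain ⟨a, rfl⟩ := hi
      obtain ⟨b, rfl⟩ := hj'
      refine ⟨a + b + 1, by omega, by omega, by omega, by omega, 0, ?_⟩
      simp only [zig, Even.add_self, if_true, hi2, if_false]
      omega
    · have hi2 := Nat.not_even_iff_odd.mpr hi
      have hj2 := Nat.not_even_iff_odd.mpr hj'
      rw [Odd.neg_one_pow hi]
      obtain ⟨a, rfl⟩ := hi
      obtain ⟨b, rfl⟩ := hj'
      refine ⟨n - (b - a), by omega, by omega, by omega, by omega, 1, ?_⟩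
      simp only [zig, hi2, hj2, if_false]
      omega
  obtain ⟨k, h1, h2, h3, h4, m, hm⟩ := key
  refine ⟨k, h1, h2, h3, h4, ?_⟩
  rw [hm]
  simp

theorem zig_add_zig_succ (i : ℕ) : zig i + zig (i + 1) = if Even i then 1 else 0 := by
  rcases Nat.even_or_odd i with hi | hi
  · have hi2 : ¬ Even (i + 1) := by simpa [Nat.even_add_one] using hi
    simp only [zig, hi, hi2, if_true, if_false]
    obtain ⟨a, rfl⟩ := hi
    omega
  · have hi1 := Nat.not_even_iff_odd.mpr hi
    have hi2 : Even (i + 1) := by simpa [Nat.even_add_one] using hi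
    simp only [zig, hi1, hi2, if_true, if_false]
    obtain ⟨a, rfl⟩ := hi
    omega

theorem zig_sub_one_cast {n : ℕ} (hn : 0 < n) : (zig n : ZMod n) = zig (n - 1) := by
  obtain ⟨m, rfl⟩ : ∃ m, n = m + 1 := ⟨n - 1, by omega⟩
  have hk : ∃ k : ℤ, zig (m + 1) = zig m + k * ((m + 1 : ℕ) : ℤ) := by
    rcases Nat.even_or_odd m with hi | hi
    · have hi2 : ¬ Even (m + 1) := by simpa [Nat.even_add_one] using hi
      refine ⟨1, ?_⟩
      simp only [zig, hi, hi2, if_true, if_false]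
      obtain ⟨a, rfl⟩ := hi
      omega
    · have hi1 := Nat.not_even_iff_odd.mpr hi
      have hi2 : Even (m + 1) := by simpa [Nat.even_add_one] using hi
      refine ⟨-1, ?_⟩
      simp only [zig, hi1, hi2, if_true, if_false]
      obtain ⟨a, rfl⟩ := hi
      omega
  obtain ⟨k, hk⟩ := hk
  rw [Nat.add_sub_cancel, hk, Int.cast_add, Int.cast_mul, Int.cast_natCast, ZMod.natCast_self,
    mul_zero, add_zero]

theorem IsCyclicLabelling.signed {n : ℕ} {v : ZMod n → Pt} (hv : IsCyclicLabelling v) {σ : ℤ}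
    (hσ : σ = 1 ∨ σ = -1) (x : ZMod n) {k l : ℕ} (hk : 0 < k) (hkl : k < l) (hl : l < n) :
    0 < σ * det2 (v (x + σ * k) - v x) (v (x + σ * l) - v x) := by
  rcases hσ with rfl | rfl
  · simpa using hv x k l hk hkl hl
  · have h := hv x (n - l) (n - k) (by omega) (by omega) (by omega)
    rw [Nat.cast_sub hl.le, Nat.cast_sub (hkl.trans hl).le, ZMod.natCast_self, det2_swap] at h
    simpa using h

/-- The vertices of a cyclically labelled polygon in zigzag order, starting at the vertex
labelled `a`. -/
def zigzagSeq {n : ℕ} (v : ZMod n → Pt) (a : ZMod n) (ε : ℤ) (i : ℕ) : Pt :=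
  v (a + ε * zig i)

theorem zigzagSeq_injOn {n : ℕ} {v : ZMod n → Pt} (hv : Function.Injective v) {ε : ℤ}
    (hε : ε = 1 ∨ ε = -1) (a : ZMod n) {i j : ℕ} (hi : i < n) (hj : j < n)
    (h : zigzagSeq v a ε i = zigzagSeq v a ε j) : i = j := by
  wlog hij : i < j generalizing i j
  · rcases (not_lt.mp hij).eq_or_lt with rfl | h'
    · rfl
    · exact (this hj hi h.symm h').symm
  exfalso
  obtain ⟨k, hk1, hk2, -, -, hk⟩ := zig_sub hij hj
  have h1 := hv h
  rw [hk] at h1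
  have h2 : (k : ZMod n) = 0 := by
    have h3 : (ε : ZMod n) * ((-1) ^ i * k) = 0 := by linear_combination -h1
    rcases hε with rfl | rfl <;> rcases neg_one_pow_eq_or (ZMod n) i with h4 | h4 <;>
      simpa [h4] using h3
  rw [ZMod.natCast_eq_zero_iff] at h2
  exact absurd (Nat.le_of_dvd (by omega) h2) (by omega)

theorem exists_zigzagSeq_eq {n : ℕ} [NeZero n] {v : ZMod n → Pt} (hv : Function.Injective v)
    {ε : ℤ} (hε : ε = 1 ∨ ε = -1) (a x : ZMod n) : ∃ i < n, a + ε * zig i = x := by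
  have hinj : Set.InjOn (fun i : ℕ => a + (ε : ZMod n) * zig i) (Finset.range n) :=
    fun i hi j hj h => zigzagSeq_injOn hv hε a (by simpa using hi) (by simpa using hj)
      (congrArg v h)
  have huniv : (Finset.range n).image (fun i : ℕ => a + (ε : ZMod n) * zig i) = Finset.univ := by
    rw [← Finset.card_eq_iff_eq_univ, Finset.card_image_of_injOn hinj, Finset.card_range, ZMod.card]
  have hx := Finset.mem_univ x
  rw [← huniv, Finset.mem_image] at hx
  obtain ⟨i, hi, h⟩ := hx
  exact ⟨i, Finset.mem_range.mp hi, h⟩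

theorem isZigzagSeq_zigzagSeq {S : Finset Pt} {n : ℕ} [NeZero n] (hS : S.card = n) (hn : 3 ≤ n)
    {v : ZMod n → Pt} (hv : IsCyclicLabelling v) (hvS : ∀ p, p ∈ S ↔ ∃ x, v x = p)
    (a : ZMod n) (s : Bool) : IsZigzagSeq S (zigzagSeq v a (if s then -1 else 1)) s := by
  have hinj := hv.injective hn
  have hε : (if s then (-1 : ℤ) else 1) = 1 ∨ (if s then (-1 : ℤ) else 1) = -1 := by
    cases s <;> simp
  refine ⟨fun i _ => (hvS _).mpr ⟨_, rfl⟩, fun p hp => ?_, ?_, ?_⟩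
  · obtain ⟨x, rfl⟩ := (hvS p).mp hp
    obtain ⟨i, hi, h⟩ := exists_zigzagSeq_eq hinj hε a x
    exact ⟨i, hS ▸ hi, congrArg v h⟩
  · rw [hS]
    exact fun i hi j hj h => zigzagSeq_injOn hinj hε a hi hj h
  · intro i j hij hj
    rw [hS] at hj
    obtain ⟨k, -, -, -, hk, hke⟩ := zig_sub (Nat.lt_succ_self i) (hij.trans hj)
    obtain rfl := hk rfl
    obtain ⟨l, -, hl2, hl3, -, hle⟩ := zig_sub (by omega : i < j) hj
    have hσ : (if s then (-1 : ℤ) else 1) * (-1) ^ i = 1 ∨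
        (if s then (-1 : ℤ) else 1) * (-1) ^ i = -1 := by
      cases s <;> rcases neg_one_pow_eq_or ℤ i with h | h <;> simp [h]
    have h := hv.signed hσ (a + (if s then (-1 : ℤ) else 1 : ℤ) * zig i) (Nat.succ_pos i)
      (hl3 hij) hl2
    have e : ∀ m : ℕ, ∀ y : ℤ, (y : ZMod n) = zig i + (-1) ^ i * m →
        a + ((if s then (-1 : ℤ) else 1 : ℤ) : ZMod n) * zig i +
          (((if s then (-1 : ℤ) else 1) * (-1) ^ i : ℤ) : ZMod n) * m =
        a + ((if s then (-1 : ℤ) else 1 : ℤ) : ZMod n) * y := fun m y hy => by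
      rw [hy]; push_cast; ring
    rw [e _ _ hke, e _ _ hle] at h
    change 0 < _ * det2 (zigzagSeq v a _ (i + 1) - zigzagSeq v a _ i)
      (zigzagSeq v a _ j - zigzagSeq v a _ i) at h
    rcases Nat.even_or_odd i with hi | hi
    · cases s <;> simpa [hi, hi.neg_one_pow] using h
    · have hi' := Nat.not_even_iff_odd.mpr hi
      cases s <;> simpa [hi', hi.neg_one_pow] using h

theorem IsZigzagSeq.eq_of_zero_eq {S : Finset Pt} {f g : ℕ → Pt} {s : Bool}
    (hf : IsZigzagSeq S f s) (hg : IsZigzagSeq S g s) (h0 : f 0 = g 0) :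
    ∀ i < S.card, f i = g i := by
  obtain ⟨hf1, hf2, hf3, hf4⟩ := hf
  obtain ⟨hg1, hg2, hg3, hg4⟩ := hg
  intro i
  induction i using Nat.strong_induction_on with
  | _ i ih =>
    intro hi
    rcases i with _ | i
    · exact h0
    by_contra hne
    obtain ⟨j, hj, hgj⟩ := hg2 _ (hf1 _ hi)
    obtain ⟨k, hk, hfk⟩ := hf2 _ (hg1 _ hi)
    have hj' : i + 1 < j := by
      by_contra hle
      rcases (not_lt.mp hle).eq_or_lt with rfl | hlt
      · exact hne hgj.symm
      · exact hlt.ne (hf3 _ hj _ hi ((ih j hlt hj).trans hgj))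
    have hk' : i + 1 < k := by
      by_contra hle
      rcases (not_lt.mp hle).eq_or_lt with rfl | hlt
      · exact hne hfk
      · exact hlt.ne (hg3 _ hk _ hi ((ih k hlt hk).symm.trans hfk))
    have h1 := hf4 i k hk' hk
    have h2 := hg4 i j hj' hj
    rw [hfk, ih i (by omega) (by omega)] at h1
    rw [hgj, det2_swap] at h2
    split_ifs at h1 h2 <;> linarith

theorem image_zigzagSeq {n : ℕ} [NeZero n] {v : ZMod n → Pt} (hv : Function.Injective v)
    (a : ZMod n) (s : Bool) :
    (Finset.range (n - 1)).image (fun i => s(zigzagSeq v a (if s then -1 else 1) i,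
      zigzagSeq v a (if s then -1 else 1) (i + 1))) =
      zigzagEdges v (2 * a - if s then 1 else 0) := by
  have hn : 0 < n := NeZero.pos n
  set ε : ℤ := if s then -1 else 1 with hεdef
  have hε : ε = 1 ∨ ε = -1 := by cases s <;> simp [hεdef]
  set c : ZMod n := 2 * a - if s then 1 else 0 with hc
  have hsum : ∀ i : ℕ, (zig i : ZMod n) + zig (i + 1) = if Even i then 1 else 0 := fun i => by
    have := zig_add_zig_succ i
    rw [← Int.cast_add, this]
    split_ifs <;> simp
  have hcε : (c = 2 * a ∧ c + 1 = 2 * a + ε) ∨ (c + 1 = 2 * a ∧ c = 2 * a + ε) := by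
    cases s
    · exact Or.inl ⟨by simp [hc], by simp [hc, hεdef]⟩
    · exact Or.inr ⟨by simp [hc], by simp [hc, hεdef, sub_eq_add_neg]⟩
  ext e
  constructor
  · intro he
    obtain ⟨i, hi, rfl⟩ := Finset.mem_image.mp he
    rw [Finset.mem_range] at hi
    refine (mem_zigzagEdges hv).mpr ⟨a + ε * zig (i + 1), rfl, fun h => ?_, ?_⟩
    · exact absurd (zigzagSeq_injOn hv hε a (by omega) (by omega) (congrArg v h)) (by omega)
    · have := hsum i
      split_ifs at this <;> grind
  · intro he
    obtain ⟨⟨x, y⟩, hxy, rfl⟩ := Finset.mem_image.mp he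
    obtain ⟨-, hxy, hadd⟩ := Finset.mem_filter.mp hxy
    dsimp only at hxy hadd ⊢
    obtain ⟨i, hi, rfl⟩ := exists_zigzagSeq_eq hv hε a x
    have hy : y = a + ε * zig (i + 1) ∨
        y = if i = 0 then a else a + ε * zig (i - 1) := by
      have h1 := hsum i
      rcases i with _ | i
      · have : zig 0 = 0 := by simp [zig]
        simp [this] at h1 hadd ⊢
        grind
      · have h2 := hsum i
        have h3 : Even (i + 1) ↔ ¬ Even i := Nat.even_add_one
        simp only [Nat.add_eq_zero_iff, one_ne_zero, and_false, if_false, Nat.add_sub_cancel]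
        by_cases h4 : Even i
        · simp only [h3, h4, not_true, if_true, if_false] at h1 h2
          grind
        · simp only [h3, h4, not_false_iff, if_true, if_false] at h1 h2
          grind
    rw [Finset.mem_image]
    rcases hy with rfl | rfl
    · have hi' : i ≠ n - 1 := by
        rintro rfl
        apply hxy
        rw [Nat.sub_add_cancel hn, zig_sub_one_cast hn]
      exact ⟨i, Finset.mem_range.mpr (by omega), rfl⟩
    · rcases i with _ | i
      · simp [zig] at hxy
      · refine ⟨i, Finset.mem_range.mpr (by omega), ?_⟩
        rw [Sym2.eq_swap]
        simp [zigzagSeq]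

theorem zigzagPaths_eq_range {S : Finset Pt} {n : ℕ} [NeZero n] (hS : S.card = n) (hn : 3 ≤ n)
    {v : ZMod n → Pt} (hv : IsCyclicLabelling v) (hvS : ∀ p, p ∈ S ↔ ∃ x, v x = p) :
    ZigzagPaths S = Set.range (zigzagEdges v) := by
  have hinj := hv.injective hn
  ext E
  constructor
  · rintro ⟨f, s, hf, rfl⟩
    obtain ⟨a, ha⟩ := (hvS _).mp (hf.1 0 (by omega))
    have hfg := hf.eq_of_zero_eq (isZigzagSeq_zigzagSeq hS hn hv hvS a s)
      (by rw [← ha]; simp [zigzagSeq, zig])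
    refine ⟨_, (image_zigzagSeq hinj a s).symm.trans ?_⟩
    rw [hS]
    refine Finset.image_congr fun i hi => ?_
    have hi' : i < n - 1 := by simpa using hi
    simp only [hfg i (by omega), hfg (i + 1) (by omega)]
  · rintro ⟨c, rfl⟩
    obtain ⟨a, s, h⟩ : ∃ (a : ZMod n) (s : Bool), 2 * a - (if s then 1 else 0) = c := by
      rcases Nat.even_or_odd' c.val with ⟨k, hk | hk⟩
      · refine ⟨k, false, ?_⟩
        rw [← ZMod.natCast_zmod_val c, hk]
        simp
      · refine ⟨k + 1, true, ?_⟩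
        rw [← ZMod.natCast_zmod_val c, hk]
        push_cast
        simp
        ring
    refine ⟨_, s, isZigzagSeq_zigzagSeq hS hn hv hvS a s, ?_⟩
    rw [hS, image_zigzagSeq hinj, h]

theorem zigzagEdges_injective {n : ℕ} [NeZero n] (hn : 3 ≤ n) {v : ZMod n → Pt}
    (hv : Function.Injective v) : Function.Injective (zigzagEdges v) := by
  intro c d hcd
  have h1 : (1 : ZMod n) ≠ 0 := by
    have := (ZMod.natCast_eq_zero_iff 1 n).not.mpr (Nat.not_dvd_of_pos_of_lt (by omega) (by omega))
    simpa using this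
  have h2 : (2 : ZMod n) ≠ 0 := by
    have := (ZMod.natCast_eq_zero_iff 2 n).not.mpr (Nat.not_dvd_of_pos_of_lt (by omega) (by omega))
    simpa using this
  obtain ⟨x, hx1, hx2⟩ : ∃ x : ZMod n, c - x ≠ x ∧ c - x + 1 ≠ x := by
    by_contra! h
    have e : ∀ x : ZMod n, c - x = x ∨ c - x + 1 = x := fun x => or_iff_not_imp_left.mpr (h x)
    rcases e 0 with e0 | e0 <;> rcases e 1 with e1 | e1 <;> rcases e 2 with e2 | e2 <;> grind
  have m1 : s(v x, v (c - x)) ∈ zigzagEdges v d :=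
    hcd ▸ (mem_zigzagEdges hv).mpr ⟨c - x, rfl, hx1, Or.inl rfl⟩
  have m2 : s(v x, v (c - x + 1)) ∈ zigzagEdges v d :=
    hcd ▸ (mem_zigzagEdges hv).mpr ⟨c - x + 1, rfl, hx2, Or.inr rfl⟩
  obtain ⟨y, hy, -, hy'⟩ := (mem_zigzagEdges hv).mp m1
  obtain ⟨z, hz, -, hz'⟩ := (mem_zigzagEdges hv).mp m2
  rw [hv hy] at hy'
  rw [hv hz] at hz'
  grind

theorem angle_eq_add_of_det2_pos {a b c : Pt} (hab : 0 < det2 a b) (hbc : 0 < det2 b c)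
    (hac : 0 < det2 a c) : InnerProductGeometry.angle a c =
      InnerProductGeometry.angle a b + InnerProductGeometry.angle b c := by
  refine (InnerProductGeometry.angle_eq_angle_add_angle_iff (ne_zero_of_det2_pos hab).2).mpr
    (Or.inr ?_)
  refine Submodule.mem_span_pair.mpr ⟨⟨_, (div_pos hbc hac).le⟩, ⟨_, (div_pos hab hac).le⟩, ?_⟩
  change (det2 b c / det2 a c) • a + (det2 a b / det2 a c) • c = b
  refine smul_right_injective Pt hac.ne' ?_
  simp only [smul_add, smul_smul, mul_div_cancel₀ _ hac.ne']
  exact (det2_smul_eq a b c).symm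

theorem angle_lt_pi_of_det2_pos {a b : Pt} (hab : 0 < det2 a b) :
    InnerProductGeometry.angle a b < Real.pi := by
  refine lt_of_le_of_ne (InnerProductGeometry.angle_le_pi _ _) fun h => ?_
  obtain ⟨-, r, -, rfl⟩ := InnerProductGeometry.angle_eq_pi_iff.mp h
  simp only [det2, PiLp.smul_apply, smul_eq_mul] at hab
  linarith

theorem angle_lt_pi_div_two_of_inner_pos {a b : Pt} (h : 0 < inner ℝ a b) :
    InnerProductGeometry.angle a b < Real.pi / 2 := by
  rw [InnerProductGeometry.angle, Real.arccos_lt_pi_div_two]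
  refine div_pos h (mul_pos ?_ ?_) <;> rw [norm_pos_iff] <;> rintro rfl <;> simp at h

/-- Two vectors at an angle of at most a right angle lie in a cone of half-angle `π / 4`. -/
theorem exists_angle_le_pi_div_four {a b : Pt} (ha : a ≠ 0) (hb : b ≠ 0)
    (hab : InnerProductGeometry.angle a b ≤ Real.pi / 2) :
    ∃ d : Pt, d ≠ 0 ∧ InnerProductGeometry.angle d a ≤ Real.pi / 4 ∧
      InnerProductGeometry.angle d b ≤ Real.pi / 4 := by
  have key : ∀ u w : Pt, ‖u‖ = 1 → ‖w‖ = 1 → 0 ≤ inner ℝ u w →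
      InnerProductGeometry.angle (u + w) u ≤ Real.pi / 4 := by
    intro u w hu hw huw
    have ht : inner ℝ u w ≤ 1 := by simpa [hu, hw] using real_inner_le_norm u w
    have hsq : ‖u + w‖ ^ 2 = 2 + 2 * inner ℝ u w := by
      rw [norm_add_sq_real, hu, hw]; ring
    have hpos : 0 < ‖u + w‖ := by
      by_contra h
      have : ‖u + w‖ = 0 := le_antisymm (not_lt.mp h) (norm_nonneg _)
      rw [this] at hsq
      linarith
    have hinner : inner ℝ (u + w) u = 1 + inner ℝ u w := by
      rw [inner_add_left, real_inner_self_eq_norm_sq, hu, real_inner_comm]; ring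
    refine (Real.strictAntiOn_cos.le_iff_ge ⟨by positivity, by linarith [Real.pi_pos]⟩
      ⟨InnerProductGeometry.angle_nonneg _ _, InnerProductGeometry.angle_le_pi _ _⟩).mp ?_
    rw [InnerProductGeometry.cos_angle, Real.cos_pi_div_four, hinner, hu, mul_one,
      div_le_div_iff₀ two_pos hpos]
    refine abs_le_of_sq_le_sq' ?_ (by linarith) |>.2
    rw [mul_pow, Real.sq_sqrt zero_le_two, hsq]
    nlinarith
  have hinner : 0 ≤ inner ℝ a b := by
    have := Real.cos_nonneg_of_mem_Icc ⟨by linarith [InnerProductGeometry.angle_nonneg a b,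
      Real.pi_pos], hab⟩
    rw [← InnerProductGeometry.cos_angle_mul_norm_mul_norm a b]
    positivity
  have hu : ‖(‖a‖⁻¹ • a)‖ = 1 := by rw [norm_smul]; simp [ha]
  have hw : ‖(‖b‖⁻¹ • b)‖ = 1 := by rw [norm_smul]; simp [hb]
  have huw : 0 ≤ inner ℝ (‖a‖⁻¹ • a) (‖b‖⁻¹ • b) := by
    rw [real_inner_smul_left, real_inner_smul_right]; positivity
  have h1 := key _ _ hu hw huw
  have h2 := key _ _ hw hu (by rwa [real_inner_comm])
  rw [InnerProductGeometry.angle_smul_right_of_pos _ _ (by positivity)] at h1 h2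
  refine ⟨‖a‖⁻¹ • a + ‖b‖⁻¹ • b, fun h => ?_, h1, by rwa [add_comm]⟩
  rw [h, InnerProductGeometry.angle_zero_left] at h1
  linarith [Real.pi_pos]

theorem angleAt_zigzagEdges {n : ℕ} [NeZero n] {v : ZMod n → Pt} (hn : 3 ≤ n)
    (hv : Function.Injective v) (x c : ZMod n) :
    angleAt (v x) (zigzagEdges v c) =
      if c - x ≠ x ∧ c - x + 1 ≠ x then ∠ (v (c - x)) (v x) (v (c - x + 1)) else 0 := by
  have h1 : c - x ≠ c - x + 1 := by
    have := (ZMod.natCast_eq_zero_iff 1 n).not.mpr (Nat.not_dvd_of_pos_of_lt (by omega) (by omega))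
    simpa using this
  by_cases h : ∃ uw : Pt × Pt, uw.1 ≠ uw.2 ∧ s(v x, uw.1) ∈ zigzagEdges v c ∧
      s(v x, uw.2) ∈ zigzagEdges v c
  · rw [angleAt, dif_pos h]
    obtain ⟨hne, hu, hw⟩ := h.choose_spec
    generalize h.choose = uw at *
    obtain ⟨y, hy, hyx, hyc⟩ := (mem_zigzagEdges hv).mp hu
    obtain ⟨z, hz, hzx, hzc⟩ := (mem_zigzagEdges hv).mp hw
    rw [← hy, ← hz] at hne ⊢
    rcases hyc with rfl | rfl <;> rcases hzc with rfl | rfl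
    · exact absurd rfl hne
    · rw [if_pos ⟨hyx, hzx⟩]
    · rw [if_pos ⟨hzx, hyx⟩, EuclideanGeometry.angle_comm]
    · exact absurd rfl hne
  · rw [angleAt, dif_neg h, if_neg]
    rintro ⟨hy, hz⟩
    exact h ⟨(v (c - x), v (c - x + 1)), fun e => h1 (hv e),
      (mem_zigzagEdges hv).mpr ⟨_, rfl, hy, Or.inl rfl⟩,
      (mem_zigzagEdges hv).mpr ⟨_, rfl, hz, Or.inr rfl⟩⟩

theorem angleAt_nonneg (p : Pt) (E : Finset (Sym2 Pt)) : 0 ≤ angleAt p E := by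
  rw [angleAt]
  split_ifs
  · exact EuclideanGeometry.angle_nonneg _ _ _
  · exact le_rfl

theorem IsCyclicLabelling.angle_add {n : ℕ} {v : ZMod n → Pt} (hv : IsCyclicLabelling v)
    (x : ZMod n) {i j k : ℕ} (hi : 0 < i) (hij : i < j) (hjk : j < k) (hk : k < n) :
    ∠ (v (x + i)) (v x) (v (x + k)) =
      ∠ (v (x + i)) (v x) (v (x + j)) + ∠ (v (x + j)) (v x) (v (x + k)) :=
  angle_eq_add_of_det2_pos (hv x i j hi hij (hjk.trans hk)) (hv x j k (hi.trans hij) hjk hk)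
    (hv x i k hi (hij.trans hjk) hk)

theorem natCast_ne_zero_of_lt {n k : ℕ} (hk : 0 < k) (hkn : k < n) : (k : ZMod n) ≠ 0 := by
  rw [Ne, ZMod.natCast_eq_zero_iff]
  exact Nat.not_dvd_of_pos_of_lt hk hkn

theorem sum_angleAt_zigzagEdges_lt {n : ℕ} [NeZero n] {v : ZMod n → Pt} (hn : 3 ≤ n)
    (hv : IsCyclicLabelling v) (x : ZMod n) :
    ∑ c, angleAt (v x) (zigzagEdges v c) < Real.pi := by
  have hinj := hv.injective hn
  set φ : ZMod n → ℝ := fun y =>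
    if y ≠ x ∧ y + 1 ≠ x then ∠ (v y) (v x) (v (y + 1)) else 0 with hφ
  have hsum : ∑ c, angleAt (v x) (zigzagEdges v c) = ∑ k ∈ Finset.range n, φ (x + k) := by
    refine Finset.sum_nbij' (fun c => (c - x - x).val) (fun k => x + x + k) ?_ ?_ ?_ ?_ ?_
    · exact fun c _ => Finset.mem_range.mpr (ZMod.val_lt _)
    · exact fun k _ => Finset.mem_univ _
    · intro c _
      simp
    · intro k hk
      have : x + x + (k : ZMod n) - x - x = k := by ring
      rw [this, ZMod.val_natCast, Nat.mod_eq_of_lt (Finset.mem_range.mp hk)]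
    · intro c _
      rw [angleAt_zigzagEdges hn hinj]
      simp [hφ]
  have hterm : ∀ k : ℕ, k + 2 < n → φ (x + (k + 1 : ℕ)) =
      ∠ (v (x + (1 : ℕ))) (v x) (v (x + (k + 2 : ℕ))) -
        ∠ (v (x + (1 : ℕ))) (v x) (v (x + (k + 1 : ℕ))) := by
    intro k hk
    have e : x + ((k + 1 : ℕ) : ZMod n) + 1 = x + (k + 2 : ℕ) := by push_cast; ring
    simp only [hφ, e]
    rw [if_pos ⟨by simpa using natCast_ne_zero_of_lt (Nat.succ_pos k) (by omega : k + 1 < n),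
      by simpa using natCast_ne_zero_of_lt (by omega : 0 < k + 2) hk⟩]
    rcases Nat.eq_zero_or_pos k with rfl | hk0
    · have : v (x + ((0 + 1 : ℕ) : ZMod n)) ≠ v x := fun h =>
        natCast_ne_zero_of_lt one_pos (by omega : 1 < n) (by simpa using hinj h)
      rw [EuclideanGeometry.angle_self_of_ne this, sub_zero]
    · rw [hv.angle_add x one_pos (by omega : 1 < k + 1) (Nat.lt_succ_self _) hk]
      ring
  obtain ⟨m, rfl⟩ : ∃ m, n = m + 2 := ⟨n - 2, by omega⟩
  have hfirst : φ (x + (0 : ℕ)) = 0 := by simp [hφ]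
  have hlast : φ (x + (m + 1 : ℕ)) = 0 := by
    have e : x + ((m + 1 : ℕ) : ZMod (m + 2)) + 1 = x := by
      have := ZMod.natCast_self (m + 2)
      push_cast at this ⊢
      linear_combination this
    simp only [hφ, e]
    simp
  rw [hsum, Finset.sum_range_succ, hlast, Finset.sum_range_succ', hfirst, add_zero, add_zero,
    Finset.sum_congr rfl fun k hk => hterm k (by simpa using hk),
    Finset.sum_range_sub
      (fun k : ℕ => ∠ (v (x + (1 : ℕ))) (v x) (v (x + (k + 1 : ℕ)))) m]
  have h1 := EuclideanGeometry.angle_nonneg (v (x + (1 : ℕ))) (v x) (v (x + (0 + 1 : ℕ)))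
  have h2 : ∠ (v (x + (1 : ℕ))) (v x) (v (x + (m + 1 : ℕ))) < Real.pi :=
    angle_lt_pi_of_det2_pos (hv x 1 (m + 1) one_pos (by omega) (by omega))
  linarith

theorem eq_of_pi_div_two_le_angleAt {n : ℕ} [NeZero n] {v : ZMod n → Pt} (hn : 3 ≤ n)
    (hv : IsCyclicLabelling v) {x c d : ZMod n}
    (hc : Real.pi / 2 ≤ angleAt (v x) (zigzagEdges v c))
    (hd : Real.pi / 2 ≤ angleAt (v x) (zigzagEdges v d)) : c = d := by
  by_contra hne
  have h := Finset.add_le_sum (f := fun c => angleAt (v x) (zigzagEdges v c))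
    (fun _ _ => angleAt_nonneg _ _) (Finset.mem_univ c) (Finset.mem_univ d) hne
  linarith [sum_angleAt_zigzagEdges_lt hn hv x]

theorem angle_lt_pi_div_two_of_dist_le {p q r : Pt} (hr : r ≠ p) (h : dist q r ≤ dist p q) :
    ∠ q p r < Real.pi / 2 := by
  refine angle_lt_pi_div_two_of_inner_pos ?_
  rw [vsub_eq_sub, vsub_eq_sub]
  have h1 := norm_sub_sq_real (q - p) (r - p)
  rw [sub_sub_sub_cancel_right, ← dist_eq_norm, ← dist_eq_norm, dist_comm q p] at h1
  have h2 : 0 < ‖r - p‖ := norm_pos_iff.mpr (sub_ne_zero.mpr hr)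
  nlinarith [dist_nonneg (x := q) (y := r)]

theorem angleAt_lt_pi_div_two_of_dist_le {n : ℕ} [NeZero n] {v : ZMod n → Pt} (hn : 3 ≤ n)
    (hv : IsCyclicLabelling v) {x y : ZMod n} (hxy : x ≠ y)
    (h : ∀ z, dist (v y) (v z) ≤ dist (v x) (v y)) (c : ZMod n) :
    angleAt (v x) (zigzagEdges v c) < Real.pi / 2 := by
  have hinj := hv.injective hn
  rw [angleAt_zigzagEdges hn hinj]
  split_ifs with hc
  swap
  · exact Real.pi_div_two_pos
  obtain ⟨h1, h2⟩ := hc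
  have hx : ∀ z, z ≠ x → ∃ i : ℕ, 0 < i ∧ i < n ∧ z = x + i := fun z hz => by
    refine ⟨(z - x).val, ?_, ZMod.val_lt _, by simp⟩
    rw [Nat.pos_iff_ne_zero, Ne, ZMod.val_eq_zero, sub_eq_zero]
    exact hz
  have hangle : ∀ z, z ≠ x → ∠ (v y) (v x) (v z) < Real.pi / 2 := fun z hz =>
    angle_lt_pi_div_two_of_dist_le (hinj.ne hz) (h z)
  obtain ⟨i, hi, hin, hci⟩ := hx _ h1
  obtain ⟨j, hj, hjn, rfl⟩ := hx y hxy.symm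
  have hci' : c - x + 1 = x + (i + 1 : ℕ) := by rw [hci]; push_cast; ring
  have hin' : i + 1 < n := by
    refine lt_of_le_of_ne hin fun e => h2 ?_
    rw [hci', show i + 1 = n from e, ZMod.natCast_self, add_zero]
  have a1 := hangle _ h1
  have a2 := hangle _ h2
  rw [hci', hci] at *
  rcases lt_trichotomy j i with hji | rfl | hji
  · rw [hv.angle_add x hj hji (Nat.lt_succ_self i) hin'] at a2
    linarith [EuclideanGeometry.angle_nonneg (v (x + j)) (v x) (v (x + i))]
  · exact a2
  · rcases (Nat.succ_le_of_lt hji).eq_or_lt with rfl | hji'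
    · rwa [EuclideanGeometry.angle_comm]
    · rw [EuclideanGeometry.angle_comm,
        hv.angle_add x hi (Nat.lt_succ_self i) hji' hjn] at a1
      linarith [EuclideanGeometry.angle_nonneg (v (x + (i + 1 : ℕ))) (v x) (v (x + j))]

theorem pathOpen_zigzagEdges {S : Finset Pt} {n : ℕ} [NeZero n] {v : ZMod n → Pt} (hn : 3 ≤ n)
    (hv : Function.Injective v) (hvS : ∀ p, p ∈ S ↔ ∃ x, v x = p) {c : ZMod n}
    (h : ∀ x, angleAt (v x) (zigzagEdges v c) < Real.pi / 2) :
    PathOpen S (zigzagEdges v c) (3 * Real.pi / 2) := by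
  intro p hp
  obtain ⟨x, rfl⟩ := (hvS p).mp hp
  have hpi : Real.pi - 3 * Real.pi / 2 / 2 = Real.pi / 4 := by ring
  rw [hpi]
  have hsub : ∀ y, y ≠ x → v y - v x ≠ 0 := fun y hy => sub_ne_zero.mpr (hv.ne hy)
  by_cases hc : c - x ≠ x ∧ c - x + 1 ≠ x
  · have hx := h x
    rw [angleAt_zigzagEdges hn hv, if_pos hc] at hx
    obtain ⟨d, hd, h1, h2⟩ := exists_angle_le_pi_div_four (hsub _ hc.1) (hsub _ hc.2) hx.le
    refine ⟨d, hd, fun q hq _ => ?_⟩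
    obtain ⟨y, rfl, -, rfl | rfl⟩ := (mem_zigzagEdges hv).mp hq
    exacts [h1, h2]
  · obtain ⟨y, hy, hyu⟩ : ∃ y, y ≠ x ∧ ∀ z, z ≠ x → (z = c - x ∨ z = c - x + 1) → z = y := by
      have h1 : (1 : ZMod n) ≠ 0 := by simpa using natCast_ne_zero_of_lt one_pos (by omega : 1 < n)
      by_cases hcx : c - x = x
      · exact ⟨x + 1, by simpa using h1, by grind⟩
      · exact ⟨c - x, hcx, by grind⟩
    refine ⟨v y - v x, hsub y hy, fun q hq _ => ?_⟩
    obtain ⟨z, rfl, hzx, hz⟩ := (mem_zigzagEdges hv).mp hq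
    rw [hyu z hzx hz, InnerProductGeometry.angle_self (hsub y hy)]
    positivity

theorem exists_two_pathOpen {S : Finset Pt} {n : ℕ} [NeZero n] {v : ZMod n → Pt} (hn : 3 ≤ n)
    (hv : IsCyclicLabelling v) (hvS : ∀ p, p ∈ S ↔ ∃ x, v x = p) :
    2 ≤ (Finset.univ.filter fun c => PathOpen S (zigzagEdges v c) (3 * Real.pi / 2)).card := by
  have hinj := hv.injective hn
  have h1 : (1 : ZMod n) ≠ 0 := by simpa using natCast_ne_zero_of_lt one_pos (by omega : 1 < n)
  obtain ⟨⟨a, b⟩, -, hab⟩ := Finset.exists_max_image (Finset.univ : Finset (ZMod n × ZMod n))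
    (fun xy => dist (v xy.1) (v xy.2)) Finset.univ_nonempty
  have hmax : ∀ x y, dist (v x) (v y) ≤ dist (v a) (v b) := fun x y => hab (x, y) (Finset.mem_univ _)
  have hne : a ≠ b := by
    rintro rfl
    have := hmax 1 0
    rw [dist_self] at this
    exact h1 (hinj (dist_le_zero.mp this))
  have hbad : ∀ c, ¬ PathOpen S (zigzagEdges v c) (3 * Real.pi / 2) →
      ∃ x, Real.pi / 2 ≤ angleAt (v x) (zigzagEdges v c) := fun c hc => by
    by_contra! h
    exact hc (pathOpen_zigzagEdges hn hinj hvS h)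
  choose! w hw using hbad
  have hcard : (Finset.univ.filter fun c =>
      ¬ PathOpen S (zigzagEdges v c) (3 * Real.pi / 2)).card ≤
        ((Finset.univ.erase a).erase b).card := by
    refine Finset.card_le_card_of_injOn w (fun c hc => ?_) fun c hc d hd hcd => ?_
    · have hwc := hw c (by simpa using hc)
      have hwa : w c ≠ a := fun e => by
        rw [e] at hwc
        exact hwc.not_gt (angleAt_lt_pi_div_two_of_dist_le hn hv hne (fun z => hmax b z) c)
      have hwb : w c ≠ b := fun e => by
        rw [e] at hwc
        exact hwc.not_gt (angleAt_lt_pi_div_two_of_dist_le hn hv hne.symm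
          (fun z => (hmax a z).trans_eq (dist_comm _ _)) c)
      simp [hwa, hwb]
    · have hwc := hw c (by simpa using hc)
      rw [hcd] at hwc
      exact eq_of_pi_div_two_le_angleAt hn hv hwc (hw d (by simpa using hd))
  rw [Finset.card_erase_of_mem (by simp [hne.symm]), Finset.card_erase_of_mem (Finset.mem_univ _),
    Finset.card_univ, ZMod.card] at hcard
  have := Finset.card_filter_add_card_filter_not (s := (Finset.univ : Finset (ZMod n)))
    (fun c => PathOpen S (zigzagEdges v c) (3 * Real.pi / 2))
  rw [Finset.card_univ, ZMod.card] at this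
  omega

/-- Zigzag-path angle accounting: for each point `p` of a set of `n ≥ 3` points in convex
position, the angles at `p` over all zigzag spanning paths sum to less than `π`, hence at
most one zigzag path has an angle `≥ π/2` at `p`; consequently at least two of the `n`
zigzag spanning paths are `3π/2`-open. -/
theorem stmt15 (S : Finset Pt) (hgp : GenPos S) (hcp : ConvexPos S)
    (h3 : 3 ≤ S.card) (hfin : (ZigzagPaths S).Finite) :
    (∀ p ∈ S, ∑ E ∈ hfin.toFinset, angleAt p E < Real.pi) ∧
    (∀ p ∈ S, {E ∈ ZigzagPaths S | Real.pi / 2 ≤ angleAt p E}.ncard ≤ 1) ∧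
    2 ≤ {E ∈ ZigzagPaths S | PathOpen S E (3 * Real.pi / 2)}.ncard := by
  obtain ⟨n, hS⟩ : ∃ n, S.card = n := ⟨_, rfl⟩
  rw [hS] at h3
  have : NeZero n := ⟨by omega⟩
  obtain ⟨v, hv, hvS⟩ := exists_cyclicLabelling hgp hcp h3 hS
  have hpaths := zigzagPaths_eq_range hS h3 hv hvS
  have hinj := zigzagEdges_injective h3 (hv.injective h3)
  refine ⟨fun p hp => ?_, fun p hp => ?_, ?_⟩
  · obtain ⟨x, rfl⟩ := (hvS p).mp hp
    have : hfin.toFinset = Finset.univ.image (zigzagEdges v) := by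
      ext E
      simp [hpaths]
    rw [this, Finset.sum_image hinj.injOn]
    exact sum_angleAt_zigzagEdges_lt h3 hv x
  · obtain ⟨x, rfl⟩ := (hvS p).mp hp
    rw [Set.ncard_le_one (hfin.subset (Set.sep_subset _ _)), hpaths]
    rintro _ ⟨⟨c, rfl⟩, hc⟩ _ ⟨⟨d, rfl⟩, hd⟩
    rw [eq_of_pi_div_two_le_angleAt h3 hv hc hd]
  · have : {E ∈ ZigzagPaths S | PathOpen S E (3 * Real.pi / 2)} =
        zigzagEdges v '' ↑(Finset.univ.filter fun c =>
          PathOpen S (zigzagEdges v c) (3 * Real.pi / 2)) := by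
      ext E
      simp only [hpaths, Set.mem_ofPred_eq, Set.mem_range, Set.mem_image, Finset.coe_filter,
        Finset.mem_univ, true_and]
      constructor
      · rintro ⟨⟨c, rfl⟩, hc⟩
        exact ⟨c, hc, rfl⟩
      · rintro ⟨c, hc, rfl⟩
        exact ⟨⟨c, rfl⟩, hc⟩
    rw [this, Set.ncard_image_of_injective _ hinj, Set.ncard_coe_finset]
    exact exists_two_pathOpen h3 hv hvS
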